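/- arXiv:2406.01901 — 2 statements merged into one kernel-verified Lean document; each statement's English description precedes it below -/
import Mathlib

section
/- Suppose F : S → ℝ satisfies F(s) > 0 for every state s, the allocation A is normalized, i.e. for every non-terminal state s one has ∑_{v ∈ Children(s)} A(v|s) = 1, for every non-initial state s' the bifurcated flow-consistency constraint ∑_{u ∈ Parents(s')} F(u)·A(s'|u) = F(s') holds (equivalently, the BN loss L_BN(s') = 0 at every non-initial state), and R : X → ℝ is a reward function with R(x) = F(x) > 0 at every terminal state x. Then for every terminal state x, the sum over all directed paths τ = (s₀ = t₀, t₁, …, t_n = x) from s₀ to x of the product ∏_{i=0}^{n-1} A(t_{i+1}|t_i) equals R(x) / (∑_{x' ∈ X} R(x')); that is, the policy given by the edge allocations A samples terminal states with probability proportional to the reward. -/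
/-- Product of the edge-allocation values along a path given as a list of states:
for `[t₀, t₁, …, tₙ]` this is `∏_{i=0}^{n-1} A tᵢ tᵢ₊₁` (with empty product `1`). -/
def pathProd {S : Type*} (A : S → S → ℝ) : List S → ℝ
  | [] => 1
  | [_] => 1
  | a :: b :: l => A a b * pathProd A (b :: l)

/-- `IsDiPath E a b l` says the list `l = [t₀, …, tₙ]` is a directed path from `a` to `b`
in the edge relation `E`: consecutive entries are joined by edges, the first entry is `a`
and the last entry is `b`. -/
def IsDiPath {S : Type*} (E : S → S → Prop) (a b : S) (l : List S) : Prop :=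
  l.Chain' E ∧ l.head? = some a ∧ l.getLast? = some b

theorem IsDiPath.nodup {S : Type*} {E : S → S → Prop}
    (hacyc : ∀ s : S, ¬ Relation.TransGen E s s) {a b : S} {l : List S}
    (h : IsDiPath E a b l) : l.Nodup := by
  have hc : l.IsChain (Relation.TransGen E) := h.1.imp fun _ _ => Relation.TransGen.single
  refine hc.pairwise.imp ?_
  rintro u _ huv rfl
  exact hacyc u huv

theorem finite_setOf_isDiPath {S : Type*} [Fintype S] {E : S → S → Prop}
    (hacyc : ∀ s : S, ¬ Relation.TransGen E s s) (a b : S) :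
    {l : List S | IsDiPath E a b l}.Finite :=
  (List.finite_length_le S (Fintype.card S)).subset fun _ hl => (hl.nodup hacyc).length_le_card

theorem setOf_isDiPath_self {S : Type*} {E : S → S → Prop} {x : S} (hx : ∀ v : S, ¬ E x v) :
    {l : List S | IsDiPath E x x l} = {[x]} := by
  ext l
  rcases l with _ | ⟨a, _ | ⟨b, l⟩⟩
  · simp [IsDiPath]
  · have hc : [a].Chain' E := List.isChain_singleton a
    simp [IsDiPath, hc]
  · simp only [IsDiPath, Set.mem_ofPred_eq, Set.mem_singleton_iff]
    constructor
    · rintro ⟨hc, ha, -⟩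
      obtain rfl : a = x := by simpa using ha
      exact absurd (List.isChain_cons_cons.1 hc).1 (hx b)
    · simp

theorem setOf_isDiPath_of_ne {S : Type*} {E : S → S → Prop} {s x : S} (hsx : s ≠ x) :
    {l : List S | IsDiPath E s x l} =
      ⋃ v ∈ {v | E s v}, List.cons s '' {l : List S | IsDiPath E v x l} := by
  ext l
  simp only [IsDiPath, Set.mem_ofPred_eq, Set.mem_iUnion, Set.mem_image, exists_prop]
  constructor
  · rintro ⟨hc, hs, hl⟩
    rcases l with _ | ⟨a, _ | ⟨b, l⟩⟩
    · simp at hs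
    · simp_all
    · obtain rfl : a = s := by simpa using hs
      obtain ⟨hab, hc⟩ := List.isChain_cons_cons.1 hc
      exact ⟨b, hab, b :: l, ⟨hc, rfl, by simpa using hl⟩, rfl⟩
  · rintro ⟨v, hv, l, ⟨hc, hh, hl⟩, rfl⟩
    rcases l with _ | ⟨b, l⟩
    · simp at hh
    · obtain rfl : b = v := by simpa using hh
      exact ⟨List.isChain_cons_cons.2 ⟨hv, hc⟩, rfl, by simpa using hl⟩

theorem pathProd_cons_of_head? {S : Type*} (A : S → S → ℝ) (s : S) {v : S} {l : List S}
    (h : l.head? = some v) : pathProd A (s :: l) = A s v * pathProd A l := by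
  rcases l with _ | ⟨b, l⟩
  · simp at h
  · obtain rfl : b = v := by simpa using h
    rfl

/-- First-step decomposition of the total weight of the directed paths from `s` to `x`. -/
theorem finsum_pathProd_of_ne {S : Type*} [Fintype S] {E : S → S → Prop} [DecidableRel E]
    (hacyc : ∀ s : S, ¬ Relation.TransGen E s s) (A : S → S → ℝ) {s x : S} (hsx : s ≠ x) :
    (∑ᶠ l ∈ {l : List S | IsDiPath E s x l}, pathProd A l) =
      ∑ v ∈ Finset.univ.filter (fun v => E s v),
        A s v * ∑ᶠ l ∈ {l : List S | IsDiPath E v x l}, pathProd A l := by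
  rw [setOf_isDiPath_of_ne hsx, finsum_mem_biUnion ?_ (Set.toFinite _)
    fun v _ => (finite_setOf_isDiPath hacyc v x).image _]
  · rw [← finsum_mem_coe_finset, Finset.coe_filter_univ]
    refine finsum_mem_congr rfl fun v _ => ?_
    rw [finsum_mem_image List.cons_injective.injOn, mul_finsum_mem]
    exact finsum_mem_congr rfl fun l hl => pathProd_cons_of_head? A s hl.2.1
  · intro v _ w _ hvw
    refine Set.disjoint_left.2 ?_
    rintro _ ⟨l, hl, rfl⟩ ⟨l', hl', h⟩
    obtain rfl : l' = l := List.cons_injective h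
    exact hvw (Option.some.inj (hl.2.1.symm.trans hl'.2.1))

/-- Summation by parts for a flow that is conserved away from the source `s₀`. -/
theorem flow_mul_source_eq_sum {S : Type*} [Fintype S] [DecidableEq S]
    {E : S → S → Prop} [DecidableRel E] {s₀ : S} (hs₀ : ∀ u : S, ¬ E u s₀)
    {F : S → ℝ} {A : S → S → ℝ}
    (hflow : ∀ s' : S, s' ≠ s₀ →
      ∑ u ∈ Finset.univ.filter (fun u => E u s'), F u * A u s' = F s')
    (Q : S → ℝ) :
    F s₀ * Q s₀ =
      ∑ s, F s * (Q s - ∑ v ∈ Finset.univ.filter (fun v => E s v), A s v * Q v) := by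
  have hswap : ∑ s, F s * ∑ v ∈ Finset.univ.filter (fun v => E s v), A s v * Q v =
      ∑ s', (∑ u ∈ Finset.univ.filter (fun u => E u s'), F u * A u s') * Q s' := by
    simp only [Finset.mul_sum, Finset.sum_mul, Finset.sum_filter]
    rw [Finset.sum_comm]
    refine Finset.sum_congr rfl fun v _ => Finset.sum_congr rfl fun u _ => ?_
    split_ifs <;> ring
  simp only [mul_sub, Finset.sum_sub_distrib]
  rw [hswap, ← Finset.sum_sub_distrib, Finset.sum_eq_single s₀]
  · simp [hs₀]
  · intro s _ hs
    rw [hflow s hs, sub_self]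
  · simp

/-- If `F` is everywhere positive, the allocation `A` is normalized over the
children of every non-terminal state, the bifurcated flow-consistency constraint
`∑_{u ∈ Parents(s')} F u * A u s' = F s'` holds at every non-initial state (i.e. the BN loss
vanishes), and the reward `R` agrees with `F` at terminal states, then for every terminal
state `x` the total probability that the path-sampling policy induced by `A` reaches `x`
equals `R x / ∑_{x' terminal} R x'`. -/
theorem bn_samples_proportionally_to_reward
    {S : Type*} [Fintype S] [DecidableEq S]
    (E : S → S → Prop) [DecidableRel E]
    -- the transitive closure of `E` is irreflexive (finite DAG)
    (hacyc : ∀ s : S, ¬ Relation.TransGen E s s)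
    (s₀ : S)
    -- the initial state has no incoming edges
    (hs₀_no_in : ∀ u : S, ¬ E u s₀)
    -- every state is reachable from the initial state
    (hreach : ∀ s : S, Relation.ReflTransGen E s₀ s)
    -- the initial state is not terminal
    (hs₀_not_term : ∃ v : S, E s₀ v)
    (F : S → ℝ)
    (hF_pos : ∀ s : S, 0 < F s)
    (A : S → S → ℝ)
    -- `A` is a nonnegative edge allocation supported on the edges
    (hA_nonneg : ∀ s s' : S, 0 ≤ A s s')
    (hA_supp : ∀ s s' : S, ¬ E s s' → A s s' = 0)
    -- normalization: at every non-terminal state the allocations over children sum to 1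
    (hA_norm : ∀ s : S, (∃ v : S, E s v) →
      ∑ v ∈ Finset.univ.filter (fun v => E s v), A s v = 1)
    -- bifurcated flow-consistency at every non-initial state (BN loss = 0)
    (hflow : ∀ s' : S, s' ≠ s₀ →
      ∑ u ∈ Finset.univ.filter (fun u => E u s'), F u * A u s' = F s')
    (R : S → ℝ)
    -- the reward equals the state flow at terminal states
    (hR : ∀ x : S, (∀ v : S, ¬ E x v) → R x = F x) :
    ∀ x : S, (∀ v : S, ¬ E x v) →
      (∑ᶠ l ∈ {l : List S | IsDiPath E s₀ x l}, pathProd A l) =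
        R x / ∑ x' ∈ Finset.univ.filter (fun x' => ∀ v : S, ¬ E x' v), R x' := by
  intro x hx
  have hpath : F s₀ * (∑ᶠ l ∈ {l : List S | IsDiPath E s₀ x l}, pathProd A l) = F x := by
    rw [flow_mul_source_eq_sum hs₀_no_in hflow
      fun s => ∑ᶠ l ∈ {l : List S | IsDiPath E s x l}, pathProd A l, Finset.sum_eq_single x]
    · simp only [setOf_isDiPath_self hx, finsum_mem_singleton]
      simp [hx, pathProd]
    · intro s _ hs
      rw [finsum_pathProd_of_ne hacyc A hs, sub_self, mul_zero]
    · simp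
  have htotal :
      ∑ x' ∈ Finset.univ.filter (fun x' => ∀ v : S, ¬ E x' v), R x' = F s₀ := by
    have h := flow_mul_source_eq_sum hs₀_no_in hflow fun _ => 1
    simp only [mul_one] at h
    rw [h, Finset.sum_filter]
    refine Finset.sum_congr rfl fun s _ => ?_
    split_ifs with hs
    · simp [hs, hR s hs]
    · push Not at hs
      rw [hA_norm s hs, sub_self, mul_zero]
  rw [htotal, hR x hx, eq_div_iff (hF_pos s₀).ne', mul_comm, hpath]
end

section
/- Let f : S × S → ℝ be a nonnegative edge flow supported on the edges E satisfying the flow matching condition ∑_{u ∈ Parents(s')} f(u → s') = ∑_{v ∈ Children(s')} f(s' → v) at every state s' that is neither initial nor terminal. Then the total outflow of the initial state equals the total inflow of the terminal states: ∑_{v ∈ Children(s₀)} f(s₀ → v) = ∑_{x ∈ X} ∑_{u ∈ Parents(x)} f(u → x). In particular, if the inflow at each terminal state x equals a reward R(x), then the total flow Z := ∑_{v ∈ Children(s₀)} f(s₀ → v) equals ∑_{x ∈ X} R(x). -/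
/-- Let `f` be a nonnegative edge flow supported on the edges satisfying
the flow matching condition at every state that is neither initial nor terminal. Then the
total outflow of the initial state equals the total inflow of the terminal states:
`∑_{v ∈ Children(s₀)} f (s₀ → v) = ∑_{x ∈ X} ∑_{u ∈ Parents(x)} f (u → x)`.
In particular, if the inflow at each terminal state `x` equals a reward `R x`, then the
total flow `Z := ∑_{v ∈ Children(s₀)} f (s₀ → v)` equals `∑_{x ∈ X} R x`. -/
theorem total_outflow_eq_total_terminal_inflow
    {S : Type*} [Fintype S]
    (E : S → S → Prop) [DecidableRel E]
    -- the transitive closure of `E` is irreflexive (finite DAG)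
    (hacyc : ∀ s : S, ¬ Relation.TransGen E s s)
    (s₀ : S)
    -- the initial state has no incoming edges
    (hs₀_no_in : ∀ u : S, ¬ E u s₀)
    -- the initial state is not terminal
    (hs₀_not_term : ∃ v : S, E s₀ v)
    (f : S → S → ℝ)
    -- `f` is a nonnegative edge flow supported on the edges
    (hf_nonneg : ∀ s s' : S, 0 ≤ f s s')
    (hf_supp : ∀ s s' : S, ¬ E s s' → f s s' = 0)
    -- flow matching at every state that is neither initial nor terminal
    (hfm : ∀ s' : S, s' ≠ s₀ → (∃ v : S, E s' v) →
      (∑ u ∈ Finset.univ.filter (fun u => E u s'), f u s') =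
        ∑ v ∈ Finset.univ.filter (fun v => E s' v), f s' v) :
    (∑ v ∈ Finset.univ.filter (fun v => E s₀ v), f s₀ v) =
      (∑ x ∈ Finset.univ.filter (fun x => ∀ v : S, ¬ E x v),
        ∑ u ∈ Finset.univ.filter (fun u => E u x), f u x) ∧
    ∀ R : S → ℝ,
      (∀ x : S, (∀ v : S, ¬ E x v) →
        (∑ u ∈ Finset.univ.filter (fun u => E u x), f u x) = R x) →
      (∑ v ∈ Finset.univ.filter (fun v => E s₀ v), f s₀ v) =
        ∑ x ∈ Finset.univ.filter (fun x => ∀ v : S, ¬ E x v), R x := by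
  classical
  have hfilter (p : S → Prop) [DecidablePred p] (g : S → ℝ) (hg : ∀ s, ¬ p s → g s = 0) :
      ∑ s ∈ Finset.univ.filter p, g s = ∑ s, g s :=
    Finset.sum_filter_of_ne fun s _ hs => not_not.mp fun hp => hs (hg s hp)
  have hin (s : S) : ∑ u ∈ Finset.univ.filter (fun u => E u s), f u s = ∑ u, f u s :=
    hfilter _ _ fun u hu => hf_supp u s hu
  have hout (s : S) : ∑ v ∈ Finset.univ.filter (fun v => E s v), f s v = ∑ v, f s v :=
    hfilter _ _ fun v hv => hf_supp s v hv
  simp only [hin, hout] at hfm ⊢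
  have hbalance (s : S) :
      (∑ u, f u s) + (if s = s₀ then ∑ v, f s v else 0) =
        (∑ v, f s v) + (if ∀ v, ¬ E s v then ∑ u, f u s else 0) := by
    by_cases hs : s = s₀
    · subst hs
      have hzero : ∑ u, f u s = 0 :=
        Finset.sum_eq_zero fun u _ => hf_supp u s (hs₀_no_in u)
      simp [hzero]
    · by_cases ht : ∀ v, ¬ E s v
      · have hzero : ∑ v, f s v = 0 := Finset.sum_eq_zero fun v _ => hf_supp s v (ht v)
        rw [if_neg hs, if_pos ht, hzero, add_comm]
      · rw [if_neg hs, if_neg ht, hfm s hs (by simpa using ht)]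
  have hmain : ∑ v, f s₀ v =
      ∑ x ∈ Finset.univ.filter (fun x => ∀ v : S, ¬ E x v), ∑ u, f u x := by
    have hsum := Finset.sum_congr rfl fun s (_ : s ∈ Finset.univ) => hbalance s
    rw [Finset.sum_add_distrib, Finset.sum_add_distrib, Finset.sum_comm, add_right_inj,
      Finset.sum_ite_eq' Finset.univ s₀, if_pos (Finset.mem_univ _)] at hsum
    rw [hsum, Finset.sum_filter]
  refine ⟨hmain, fun R hR => hmain.trans (Finset.sum_congr rfl fun x hx => ?_)⟩
  exact hR x (Finset.mem_filter.mp hx).2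
end
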